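/- Let A be a C*-algebra and let I be a closed right ideal of A. Then I ∩ r_A(I*) = {0}, the right ideal J := I + r_A(I*) is norm-closed with ℓ_A(J) = {0}, and for every bounded right A-module map f : I → A the map f̃ : J → A defined by f̃(x + y) = f(x) for x ∈ I and y ∈ r_A(I*) is a well-defined bounded right A-module map extending f with ‖f̃‖ = ‖f‖. -/

import Mathlib

variable {A : Type*} [NonUnitalCStarAlgebra A]

/-- A submodule `J ⊆ A` is a right ideal if it is closed under right multiplication
by arbitrary elements of `A`. -/
def IsRightIdeal (J : Submodule ℂ A) : Prop :=
  ∀ x ∈ J, ∀ a : A, x * a ∈ J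

/-- The right annihilator `r_A(I*) = {a ∈ A : x* a = 0 for all x ∈ I}` of `I*`,
as a submodule of `A`. -/
def rAnnStar (I : Submodule ℂ A) : Submodule ℂ A where
  carrier := {a : A | ∀ x ∈ I, star x * a = 0}
  add_mem' := by
    intro a b ha hb x hx
    rw [mul_add, ha x hx, hb x hx, add_zero]
  zero_mem' := by
    intro x hx
    simp
  smul_mem' := by
    intro c a ha x hx
    rw [mul_smul_comm, ha x hx, smul_zero]

theorem isRightIdeal_rAnnStar (I : Submodule ℂ A) : IsRightIdeal (rAnnStar I) := by
  intro y hy a x hx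
  rw [← mul_assoc, hy x hx, zero_mul]

theorem isClosed_rAnnStar (I : Submodule ℂ A) : IsClosed (rAnnStar I : Set A) := by
  have h : (rAnnStar I : Set A) = ⋂ x ∈ I, {a : A | star x * a = 0} := by
    ext a
    simp [rAnnStar]
  rw [h]
  exact isClosed_biInter fun x _ => isClosed_eq (by fun_prop) continuous_const

/-- The projection of `I + r_A(I*)` onto `I` along `r_A(I*)` is contractive. -/
theorem norm_le_norm_add_of_mem_rAnnStar {I : Submodule ℂ A} {x y : A} (hx : x ∈ I)
    (hy : y ∈ rAnnStar I) : ‖x‖ ≤ ‖x + y‖ := by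
  rcases (norm_nonneg x).eq_or_lt with h | h
  · exact h ▸ norm_nonneg _
  · refine le_of_mul_le_mul_left ?_ h
    calc ‖x‖ * ‖x‖ = ‖star x * (x + y)‖ := by
          rw [mul_add, hy x hx, add_zero, CStarRing.norm_star_mul_self]
      _ ≤ ‖x‖ * ‖x + y‖ := (norm_mul_le _ _).trans_eq (by rw [norm_star])

theorem eq_of_add_eq_add_of_mem_rAnnStar {I : Submodule ℂ A} {x x' y y' : A} (hx : x ∈ I)
    (hx' : x' ∈ I) (hy : y ∈ rAnnStar I) (hy' : y' ∈ rAnnStar I) (h : x + y = x' + y') :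
    x = x' := by
  have hle := norm_le_norm_add_of_mem_rAnnStar (I.sub_mem hx hx')
    ((rAnnStar I).sub_mem hy hy')
  rw [sub_add_sub_comm, h, sub_self, norm_zero] at hle
  exact sub_eq_zero.1 (norm_le_zero_iff.1 hle)

theorem isClosed_sup_rAnnStar {I : Submodule ℂ A} (hIc : IsClosed (I : Set A)) :
    IsClosed ((I ⊔ rAnnStar I : Submodule ℂ A) : Set A) := by
  have : CompleteSpace I := hIc.completeSpace_coe
  have : CompleteSpace (rAnnStar I) := (isClosed_rAnnStar I).completeSpace_coe
  let φ : I × rAnnStar I →L[ℂ] A := I.subtypeL.coprod (rAnnStar I).subtypeL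
  have hφ : AntilipschitzWith 2 φ := by
    refine AddMonoidHomClass.antilipschitz_of_bound φ fun p => ?_
    have h₁ : ‖(p.1 : A)‖ ≤ ‖(p.1 : A) + p.2‖ :=
      norm_le_norm_add_of_mem_rAnnStar p.1.2 p.2.2
    have h₂ : ‖(p.2 : A)‖ ≤ ‖(p.1 : A) + p.2‖ + ‖(p.1 : A)‖ := by
      simpa using norm_sub_le ((p.1 : A) + p.2) p.1
    change max ‖(p.1 : A)‖ ‖(p.2 : A)‖ ≤ 2 * ‖(p.1 : A) + p.2‖
    exact max_le (by linarith [norm_nonneg (p.1 : A)]) (by linarith)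
  have hrange : ((I ⊔ rAnnStar I : Submodule ℂ A) : Set A) = Set.range φ := by
    rw [Submodule.sup_eq_range]
    rfl
  rw [hrange]
  exact hφ.isClosed_range φ.uniformContinuous

theorem eq_zero_of_mul_sup_rAnnStar_eq_zero {I : Submodule ℂ A} {b : A}
    (hb : ∀ z ∈ I ⊔ rAnnStar I, b * z = 0) : b = 0 := by
  have hmem : star b ∈ rAnnStar I := fun x hx => by
    rw [← star_mul, hb x (Submodule.mem_sup_left hx), star_zero]
  exact CStarRing.mul_star_self_eq_zero_iff b |>.1 (hb _ (Submodule.mem_sup_right hmem))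

/-- Every bounded map on `I` extends to `I + r_A(I*)` by zero on `r_A(I*)`, without increasing
the norm. -/
theorem exists_extension_sup_rAnnStar {I : Submodule ℂ A} (f : I →L[ℂ] A) :
    ∃ g : (I ⊔ rAnnStar I : Submodule ℂ A) →L[ℂ] A,
      (∀ (x y : A) (hx : x ∈ I) (hy : y ∈ rAnnStar I),
        g ⟨x + y, Submodule.add_mem _ (Submodule.mem_sup_left hx)
            (Submodule.mem_sup_right hy)⟩ = f ⟨x, hx⟩) ∧ ‖g‖ = ‖f‖ := by
  choose p hp q hq hpq using
    fun z : (I ⊔ rAnnStar I : Submodule ℂ A) => Submodule.mem_sup.1 z.2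
  have p_eq : ∀ (z : (I ⊔ rAnnStar I : Submodule ℂ A)) (x y : A), x ∈ I → y ∈ rAnnStar I →
      x + y = z → p z = x :=
    fun z x y hx hy h =>
      eq_of_add_eq_add_of_mem_rAnnStar (hp z) hx (hq z) hy ((hpq z).trans h.symm)
  let P : (I ⊔ rAnnStar I : Submodule ℂ A) →ₗ[ℂ] I :=
    { toFun := fun z => ⟨p z, hp z⟩
      map_add' := fun z w => Subtype.ext <|
        p_eq _ (p z + p w) _ (I.add_mem (hp z) (hp w)) ((rAnnStar I).add_mem (hq z) (hq w)) <| by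
          rw [add_add_add_comm, hpq, hpq, Submodule.coe_add]
      map_smul' := fun c z => Subtype.ext <|
        p_eq _ (c • p z) _ (I.smul_mem c (hp z)) ((rAnnStar I).smul_mem c (hq z)) <| by
          rw [← smul_add, hpq, Submodule.coe_smul] }
  have norm_P_le : ∀ z, ‖P z‖ ≤ ‖z‖ := fun z =>
    (norm_le_norm_add_of_mem_rAnnStar (hp z) (hq z)).trans_eq (congrArg norm (hpq z))
  have bound : ∀ z, ‖(f.toLinearMap ∘ₗ P) z‖ ≤ ‖f‖ * ‖z‖ := fun z =>
    f.le_opNorm_of_le (norm_P_le z)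
  let g := (f.toLinearMap ∘ₗ P).mkContinuous ‖f‖ bound
  have hg : ∀ (x y : A) (hx : x ∈ I) (hy : y ∈ rAnnStar I),
      g ⟨x + y, Submodule.add_mem _ (Submodule.mem_sup_left hx)
          (Submodule.mem_sup_right hy)⟩ = f ⟨x, hx⟩ := fun x y hx hy =>
    congrArg f (Subtype.ext (p_eq _ x y hx hy rfl))
  refine ⟨g, hg, le_antisymm (LinearMap.mkContinuous_norm_le _ (norm_nonneg f) bound) ?_⟩
  refine f.opNorm_le_bound (norm_nonneg g) fun x => ?_
  rw [← hg x 0 x.2 (zero_mem _)]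
  refine g.le_opNorm_of_le ?_
  simp

theorem stmt11 (I : Submodule ℂ A) (hIr : IsRightIdeal I) (hIc : IsClosed (I : Set A)) :
    ((I : Set A) ∩ (rAnnStar I : Set A) = {0}) ∧
    IsClosed ((I ⊔ rAnnStar I : Submodule ℂ A) : Set A) ∧
    (∀ b : A, (∀ z ∈ I ⊔ rAnnStar I, b * z = 0) → b = 0) ∧
    (∀ f : I →L[ℂ] A,
      (∀ (x : I) (a : A) (hxa : (x : A) * a ∈ I), f ⟨(x : A) * a, hxa⟩ = f x * a) →
      ∃ g : (I ⊔ rAnnStar I : Submodule ℂ A) →L[ℂ] A,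
        (∀ (x y : A) (hx : x ∈ I) (hy : y ∈ rAnnStar I),
          g ⟨x + y, Submodule.add_mem _ (Submodule.mem_sup_left hx)
              (Submodule.mem_sup_right hy)⟩ = f ⟨x, hx⟩) ∧
        (∀ (z : (I ⊔ rAnnStar I : Submodule ℂ A)) (a : A)
            (hza : (z : A) * a ∈ I ⊔ rAnnStar I), g ⟨(z : A) * a, hza⟩ = g z * a) ∧
        ‖g‖ = ‖f‖) := by
  refine ⟨?_, isClosed_sup_rAnnStar hIc, fun b => eq_zero_of_mul_sup_rAnnStar_eq_zero,
    fun f hf => ?_⟩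
  · ext x
    refine ⟨fun ⟨hxI, hxR⟩ => CStarRing.star_mul_self_eq_zero_iff x |>.1 (hxR x hxI), ?_⟩
    rintro rfl
    exact ⟨zero_mem _, zero_mem _⟩
  · obtain ⟨g, hg, hnorm⟩ := exists_extension_sup_rAnnStar f
    refine ⟨g, hg, ?_, hnorm⟩
    rintro ⟨z, hz⟩ a hza
    obtain ⟨x, hx, y, hy, rfl⟩ := Submodule.mem_sup.1 hz
    simp only [add_mul]
    rw [hg x y hx hy, hg (x * a) (y * a) (hIr x hx a) (isRightIdeal_rAnnStar I y hy a)]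
    exact hf ⟨x, hx⟩ a _
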